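/- Every smooth complex projective quadric surface bundle X → ℙ² of type (d₀, d₁, d₂, d₃), with the d_i non-negative integers of the same parity, deforms (within the family of hypersurfaces in ℙ(E) defined by symmetric matrices (a_{ij}) of homogeneous forms) to a smooth quadric surface bundle over ℙ² admitting a section, hence to a smooth rational projective fourfold; this deformation is obtained by specializing the entry a₃₃ to 0. -/

import Mathlib

/-!
Rationality, stable rationality and stable birationality, expressed via function fields:
a variety `X` over `k` with function field `F` (a `k`-algebra via `c : k →+* F`) is rational
iff `F ≅ k(t₁,…,t_n)` over `k`, and stably rational iff `F(t₁,…,t_m) ≅ k(t₁,…,t_n)` over `k`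
for some `m, n`. Two varieties are stably birational iff their function fields become
isomorphic after adjoining finitely many indeterminates.
-/

noncomputable section

/-- The rational function field `k(t₁, …, t_n)`. -/
def ratFuncField (k : Type) [Field k] (n : ℕ) : Type :=
  FractionRing (MvPolynomial (Fin n) k)

instance (k : Type) [Field k] (n : ℕ) : Field (ratFuncField k n) := by
  unfold ratFuncField; infer_instance

/-- The canonical map `k → k(t₁, …, t_n)`. -/
def ratFuncFieldMap (k : Type) [Field k] (n : ℕ) : k →+* ratFuncField k n :=
  (algebraMap (MvPolynomial (Fin n) k) (FractionRing (MvPolynomial (Fin n) k))).comp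
    (MvPolynomial.C)

/-- Given a function field `F` over `k` (via `c : k →+* F`), the canonical map
`k → Frac(F[t₁,…,t_m]) = F(t₁,…,t_m)`. -/
def adjoinIndetsMap {k F : Type} [CommRing k] [CommRing F] (c : k →+* F) (m : ℕ) :
    k →+* FractionRing (MvPolynomial (Fin m) F) :=
  (algebraMap (MvPolynomial (Fin m) F) (FractionRing (MvPolynomial (Fin m) F))).comp
    ((MvPolynomial.C).comp c)

/-- A variety over `k` with function field `F` (via `c : k →+* F`) is rational iff
`F ≅ k(t₁,…,t_n)` as `k`-algebras for some `n`. -/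
def IsRationalFunctionField {k F : Type} [Field k] [CommRing F] (c : k →+* F) : Prop :=
  ∃ (n : ℕ) (e : F ≃+* ratFuncField k n), (e : F →+* ratFuncField k n).comp c =
    ratFuncFieldMap k n

/-- A variety over `k` with function field `F` (via `c : k →+* F`) is stably rational iff
`F(t₁,…,t_m) ≅ k(t₁,…,t_n)` as `k`-algebras for some `m, n`. -/
def IsStablyRationalFunctionField {k F : Type} [Field k] [CommRing F] (c : k →+* F) : Prop :=
  ∃ (m n : ℕ) (e : FractionRing (MvPolynomial (Fin m) F) ≃+* ratFuncField k n),
    (e : FractionRing (MvPolynomial (Fin m) F) →+* ratFuncField k n).comp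
      (adjoinIndetsMap c m) = ratFuncFieldMap k n

/-- Two varieties over `K` with function fields `L₁, L₂` (via `i₁ : K →+* L₁`,
`i₂ : K →+* L₂`) are stably birational over `K` iff `L₁(t₁,…,t_a) ≅ L₂(t₁,…,t_b)`
as `K`-algebras for some `a, b`. -/
def StablyBirationalOver {K L₁ L₂ : Type} [Field K] [CommRing L₁] [CommRing L₂]
    (i₁ : K →+* L₁) (i₂ : K →+* L₂) : Prop :=
  ∃ (a b : ℕ) (e : FractionRing (MvPolynomial (Fin a) L₁) ≃+*
      FractionRing (MvPolynomial (Fin b) L₂)),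
    (e : FractionRing (MvPolynomial (Fin a) L₁) →+*
      FractionRing (MvPolynomial (Fin b) L₂)).comp (adjoinIndetsMap i₁ a) =
      adjoinIndetsMap i₂ b

end

/-!
Very general members of linear families, and quadric surface bundles over `ℙ²` given by
symmetric matrices of homogeneous forms, described via affine charts and function fields.
-/

noncomputable section

/-- A polynomial function on a `ℂ`-vector space `P`: a function factoring through finitely
many linear coordinates via a polynomial. -/
def IsPolynomialFun {P : Type} [AddCommGroup P] [Module ℂ P] (f : P → ℂ) : Prop :=
  ∃ (N : ℕ) (l : Fin N → (P →ₗ[ℂ] ℂ)) (F : MvPolynomial (Fin N) ℂ),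
    ∀ p : P, f p = MvPolynomial.eval (fun i => l i p) F

/-- A property `Q` holds for a very general member of the linear parameter space `P` if it
holds away from a countable union of proper algebraic hypersurfaces, i.e. if there are
countably many nonzero polynomial functions on `P` such that `Q p` holds whenever none of
them vanishes at `p`. -/
def VeryGeneral {P : Type} [AddCommGroup P] [Module ℂ P] (Q : P → Prop) : Prop :=
  ∃ 𝒞 : Set (P → ℂ), 𝒞.Countable ∧ (∀ f ∈ 𝒞, IsPolynomialFun f ∧ f ≠ 0) ∧
    ∀ p : P, (∀ f ∈ 𝒞, f p ≠ 0) → Q p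

/-- Dehomogenization `ℂ[x,y,z] → ℂ[x,y] ⊆ ℂ[x,y,z₁,z₂,z₃]` at the chart `z = 1` of `ℙ²`
(the first two variables of `Fin 5` are the base coordinates). -/
def dehomP2 : MvPolynomial (Fin 3) ℂ →+* MvPolynomial (Fin 5) ℂ :=
  (MvPolynomial.aeval ![MvPolynomial.X 0, MvPolynomial.X 1, 1]).toRingHom

/-- Dehomogenization `ℂ[x,y,z] → ℂ[x,y]` at the chart `z = 1`. -/
def dehomP2' : MvPolynomial (Fin 3) ℂ →+* MvPolynomial (Fin 2) ℂ :=
  (MvPolynomial.aeval ![MvPolynomial.X 0, MvPolynomial.X 1, 1]).toRingHom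

/-- The defining polynomial `∑_{i,j} a_{ij}(x,y,1) z_i z_j` (with `z₀ = 1`) of the affine
chart of the quadric surface bundle `X = {∑ a_{ij} z_i z_j = 0} ⊆ ℙ(E)` over `ℙ²`. -/
def quadricBundleChartPoly (A : Fin 4 → Fin 4 → MvPolynomial (Fin 3) ℂ) :
    MvPolynomial (Fin 5) ℂ :=
  ∑ i : Fin 4, ∑ j : Fin 4, dehomP2 (A i j) *
    (![1, MvPolynomial.X 2, MvPolynomial.X 3, MvPolynomial.X 4] i) *
    (![1, MvPolynomial.X 2, MvPolynomial.X 3, MvPolynomial.X 4] j)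

/-- The coordinate ring of the affine chart (`z = 1` on `ℙ²` and `z₀ = 1` on the fibre)
of the quadric surface bundle `X ⊆ ℙ(E)` over `ℙ²` determined by the symmetric matrix
`(a_{ij})`. -/
def quadricBundleChartRing (A : Fin 4 → Fin 4 → MvPolynomial (Fin 3) ℂ) : Type :=
  MvPolynomial (Fin 5) ℂ ⧸ Ideal.span {quadricBundleChartPoly A}

instance (A : Fin 4 → Fin 4 → MvPolynomial (Fin 3) ℂ) :
    CommRing (quadricBundleChartRing A) :=
  Ideal.Quotient.commRing _

/-- The function field `ℂ(X)` of the quadric surface bundle `X` over `ℙ²` given by the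
matrix `(a_{ij})`, as the fraction ring of the affine chart. -/
def quadricBundleFunctionField (A : Fin 4 → Fin 4 → MvPolynomial (Fin 3) ℂ) : Type :=
  FractionRing (quadricBundleChartRing A)

instance (A : Fin 4 → Fin 4 → MvPolynomial (Fin 3) ℂ) :
    CommRing (quadricBundleFunctionField A) := by
  unfold quadricBundleFunctionField; infer_instance

/-- The canonical map `ℂ → ℂ(X)`. -/
def quadricBundleFFMap (A : Fin 4 → Fin 4 → MvPolynomial (Fin 3) ℂ) :
    ℂ →+* quadricBundleFunctionField A :=
  (algebraMap (quadricBundleChartRing A) (FractionRing (quadricBundleChartRing A))).comp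
    ((Ideal.Quotient.mk _).comp (MvPolynomial.C))

/-- The conditions for the symmetric matrix `(a_{ij})` of forms to define a quadric surface
bundle over `ℙ²`: the quadratic form is generically nondegenerate, and nonzero on every
fibre (so that `X → ℙ²` is flat). Homogeneity of the `a_{ij}` of the correct degrees is
part of the choice of parameter space. -/
def IsQuadricBundleP2 (A : Fin 4 → Fin 4 → MvPolynomial (Fin 3) ℂ) : Prop :=
  Matrix.det (Matrix.of fun i j => A i j + A j i) ≠ 0 ∧
  ∀ v : Fin 3 → ℂ, v ≠ 0 → ∃ i j, MvPolynomial.eval v (A i j + A j i) ≠ 0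

/-- The quadric surface bundle over `ℙ²` given by `(a_{ij})` admits a rational section:
there are rational functions `σ₀, …, σ₃` on `ℙ²`, not all zero, with
`∑ a_{ij} σ_i σ_j = 0`. -/
def HasRationalSectionP2 (A : Fin 4 → Fin 4 → MvPolynomial (Fin 3) ℂ) : Prop :=
  ∃ σ : Fin 4 → FractionRing (MvPolynomial (Fin 2) ℂ), σ ≠ 0 ∧
    ∑ i : Fin 4, ∑ j : Fin 4,
      (algebraMap (MvPolynomial (Fin 2) ℂ) (FractionRing (MvPolynomial (Fin 2) ℂ)))
        (dehomP2' (A i j)) * σ i * σ j = 0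

end

/-!
STATEMENT 17: Every smooth complex projective quadric surface bundle `X → ℙ²` of type
`(d₀,d₁,d₂,d₃)` deforms, within the family of hypersurfaces in `ℙ(E)` defined by symmetric
matrices `(a_{ij})` of homogeneous forms, to a smooth quadric surface bundle over `ℙ²`
admitting a (rational) section — obtained by specializing the entry `a₃₃` to `0` — and
hence to a smooth rational projective fourfold. (Smoothness is expressed by the Jacobian
criterion on the three standard charts of `ℙ²`.)
-/

noncomputable section

/-- The three standard charts of `ℙ²`: substitution of `1` for one of the three base
variables; the remaining two become the first two variables of `ℂ[u,v,z₀,z₁,z₂,z₃]`. -/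
def chartSubstP2 : Fin 3 → (Fin 3 → MvPolynomial (Fin 6) ℂ) :=
  ![![1, MvPolynomial.X 0, MvPolynomial.X 1],
    ![MvPolynomial.X 0, 1, MvPolynomial.X 1],
    ![MvPolynomial.X 0, MvPolynomial.X 1, 1]]

/-- The defining polynomial of the bundle `X ⊆ ℙ(E)` on the base chart `c`, with all four
(fibrewise homogeneous) fibre coordinates `z₀,…,z₃` kept. -/
def bundleTotalChartPoly (c : Fin 3) (A : Fin 4 → Fin 4 → MvPolynomial (Fin 3) ℂ) :
    MvPolynomial (Fin 6) ℂ :=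
  ∑ i : Fin 4, ∑ j : Fin 4, (MvPolynomial.aeval (chartSubstP2 c)) (A i j) *
    (![MvPolynomial.X 2, MvPolynomial.X 3, MvPolynomial.X 4, MvPolynomial.X 5] i) *
    (![MvPolynomial.X 2, MvPolynomial.X 3, MvPolynomial.X 4, MvPolynomial.X 5] j)

/-- Smoothness of the total space `X ⊆ ℙ(E)` of a quadric surface bundle over `ℙ²`, by the
Jacobian criterion on each of the three standard charts: no point with nonzero fibre
coordinates at which the full gradient vanishes (by the Euler relation in the fibre
variables, such a point would automatically lie on `X` and be singular there). -/
def IsSmoothBundleP2 (A : Fin 4 → Fin 4 → MvPolynomial (Fin 3) ℂ) : Prop :=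
  ∀ (c : Fin 3) (p : Fin 6 → ℂ), (![p 2, p 3, p 4, p 5] : Fin 4 → ℂ) ≠ 0 →
    ¬ ∀ m : Fin 6, MvPolynomial.eval p (MvPolynomial.pderiv m (bundleTotalChartPoly c A)) = 0


open scoped TensorProduct in
/-- Derivations extend along formally étale algebras. -/
theorem Derivation.exists_extension_of_formallyEtale {R S T : Type*} [CommRing R] [CommRing S] [CommRing T]
    [Algebra R S] [Algebra R T] [Algebra S T] [IsScalarTower R S T] [Algebra.FormallyEtale S T]
    (d : Derivation R S T) : ∃ D : Derivation R T T, ∀ s, D (algebraMap S T s) = d s := by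
  let e := KaehlerDifferential.tensorKaehlerEquivOfFormallyEtale R S T
  let φ : T ⊗[S] Ω[S⁄R] →ₗ[T] T :=
    (TensorProduct.isBaseChange S Ω[S⁄R] T).lift d.liftKaehlerDifferential
  refine ⟨(φ ∘ₗ e.symm.toLinearMap).compDer (KaehlerDifferential.D R T), fun s => ?_⟩
  have h := KaehlerDifferential.tensorKaehlerEquivOfFormallyEtale_symm_D_algebraMap
    (R := R) (S := S) (T := T) s
  have h2 := IsBaseChange.lift_eq (TensorProduct.isBaseChange S Ω[S⁄R] T) d.liftKaehlerDifferential
    (KaehlerDifferential.D R S s)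
  simp only [TensorProduct.mk_apply, Derivation.liftKaehlerDifferential_comp_D] at h2
  exact (congrArg φ h).trans h2

/-- The partial derivative along a member of a transcendence basis extends to the whole field. -/
theorem IsTranscendenceBasis.exists_dual_derivation {F K ι : Type*} [Field F] [Field K] [Algebra F K]
    [CharZero F] {v : ι → K} (hv : IsTranscendenceBasis F v) [DecidableEq ι] (i : ι) :
    ∃ D : Derivation F K K, ∀ j, D (v j) = if i = j then 1 else 0 := by
  let S := Algebra.adjoin F (Set.range v)
  have : CharZero (FractionRing S) :=
    charZero_of_injective_algebraMap (algebraMap F (FractionRing S)).injective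
  have h1 : Algebra.IsAlgebraic S K := hv.isAlgebraic
  let := FractionRing.liftAlgebra S K
  have h2 : Algebra.IsAlgebraic (FractionRing S) K :=
    (IsFractionRing.comap_isAlgebraic_iff (A := S) (K := FractionRing S) (C := K)).mp h1
  have h3 : Algebra.FormallyEtale S (FractionRing S) :=
    Algebra.FormallyEtale.of_isLocalization (nonZeroDivisors S)
  have h4 : Algebra.FormallyEtale (FractionRing S) K := Algebra.FormallyEtale.of_isSeparable _ _
  have h5 : Algebra.FormallyEtale S K := .comp S (FractionRing S) K
  let e := hv.1.aevalEquiv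
  let d : Derivation F S K := Derivation.mk'
    ((MvPolynomial.aeval v).toLinearMap ∘ₗ (MvPolynomial.pderiv (R := F) i).toLinearMap ∘ₗ
      e.symm.toLinearMap) (by
      intro a b
      have key : ∀ x : S, MvPolynomial.aeval v (e.symm x) = (x : K) := fun x => by
        conv_rhs => rw [← e.apply_symm_apply x]
        exact (hv.1.algebraMap_aevalEquiv _).symm
      simp [key, Algebra.smul_def])
  obtain ⟨D, hD⟩ := d.exists_extension_of_formallyEtale (T := K)
  refine ⟨D, fun j => ?_⟩
  have := hD (e (MvPolynomial.X j))
  rw [hv.1.algebraMap_aevalEquiv] at this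
  simp only [MvPolynomial.aeval_X] at this
  rw [this]
  simp [d, MvPolynomial.pderiv_X, Pi.single_apply, eq_comm]

/-- There are finitely many complex numbers `tᵢ` with derivations `∂/∂tᵢ` of `ℂ` dual to them. -/
theorem exists_dual_derivations (ι : Type) [Finite ι] [DecidableEq ι] :
    ∃ (t : ι → ℂ) (D : ι → Derivation ℚ ℂ ℂ), ∀ i j, D i (t j) = if i = j then 1 else 0 := by
  classical
  obtain ⟨s, hs⟩ := exists_isTranscendenceBasis ℚ ℂ
  have hc := IsAlgClosed.cardinal_eq_cardinal_transcendence_basis_of_aleph0_lt' _ hs (by simp)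
    (by rw [Cardinal.mk_complex]; exact Cardinal.aleph0_lt_continuum)
  have hle : Cardinal.mk ι ≤ Cardinal.mk s := by
    rw [← hc, Cardinal.mk_complex]
    exact (Cardinal.lt_aleph0_of_finite ι).le.trans Cardinal.aleph0_le_continuum
  obtain ⟨f⟩ := hle
  choose D hD using hs.exists_dual_derivation
  exact ⟨fun i => f i, fun i => D (f i), fun i j => by simp [hD]⟩

/-- Differentiating coefficients and evaluating at `p`; by the chain rule this kills every `f` that
is singular at `p` with `f p = 0`. -/
theorem MvPolynomial.exists_coeff_derivation {σ : Type*} [Fintype σ] (D : Derivation ℚ ℂ ℂ) (p : σ → ℂ) :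
    ∃ E : MvPolynomial σ ℂ →+ ℂ, (∀ a, E (C a) = D a) ∧ (∀ i, E (X i) = 0) ∧
      (∀ f g, E (f * g) = eval p f * E g + eval p g * E f) ∧
      ∀ f, (∀ m, eval p (pderiv m f) = 0) → eval p f = 0 → E f = 0 := by
  classical
  refine ⟨AddMonoidHom.mk' (fun f => D (eval p f) - ∑ m, eval p (pderiv m f) * D (p m)) ?_,
    ?_, ?_, ?_, ?_⟩
  · intro f g
    simp only [map_add, add_mul, Finset.sum_add_distrib]
    ring
  · intro a
    simp
  · intro i
    simp [pderiv_X, Pi.single_apply, apply_ite]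
  · intro f g
    simp only [AddMonoidHom.mk'_apply, map_mul, Derivation.leibniz, smul_eq_mul, map_add, add_mul,
      Finset.sum_add_distrib, mul_sub, Finset.mul_sum, mul_assoc]
    ring
  · intro f h h0
    simp [h, h0]

theorem MvPolynomial.dvd_sub_of_forall_X {σ R : Type*} [CommRing R] {q : MvPolynomial σ R}
    (ψ : MvPolynomial σ R →ₐ[R] MvPolynomial σ R) (h : ∀ j, q ∣ X j - ψ (X j)) (F : MvPolynomial σ R) :
    q ∣ F - ψ F := by
  have : (Ideal.Quotient.mkₐ R (Ideal.span {q})) = (Ideal.Quotient.mkₐ R (Ideal.span {q})).comp ψ := by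
    ext j
    simpa [Ideal.Quotient.eq, Ideal.mem_span_singleton] using h j
  have := DFunLike.congr_fun this F
  simpa [Ideal.Quotient.eq, Ideal.mem_span_singleton] using this

/-- A retraction of a polynomial ring with principal kernel has a prime generator. -/
theorem MvPolynomial.prime_of_retraction {σ R : Type*} [CommRing R] [IsDomain R] {q : MvPolynomial σ R}
    (ψ : MvPolynomial σ R →ₐ[R] MvPolynomial σ R) (h : ∀ j, q ∣ X j - ψ (X j))
    (hq : ψ q = 0) (hq0 : q ≠ 0) : Prime q := by
  have key : ∀ F, ψ F = 0 → q ∣ F := fun F hF => by simpa [hF] using dvd_sub_of_forall_X ψ h F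
  refine ⟨hq0, fun hu => ?_, fun a b hab => ?_⟩
  · simpa [hq] using hu.map ψ
  · have : ψ a * ψ b = 0 := by
      rw [← map_mul]
      obtain ⟨c, hc⟩ := hab
      rw [hc, map_mul, hq, zero_mul]
    exact (mul_eq_zero.mp this).imp (key a) (key b)

theorem FractionRing.exists_ringEquiv_of_injective {R K : Type*} [CommRing R] [Field K] (π : R →+* K)
    (hπ : Function.Injective π) (hsurj : ∀ z, ∃ a b, z = π a / π b) :
    ∃ e : FractionRing R ≃+* K, ∀ a, e (algebraMap R (FractionRing R) a) = π a := by
  let := π.toAlgebra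
  have : FaithfulSMul R K := (faithfulSMul_iff_algebraMap_injective _ _).mpr hπ
  have : IsFractionRing R K := IsFractionRing.of_field _ _ hsurj
  let e := IsLocalization.algEquiv (nonZeroDivisors R) (FractionRing R) K
  exact ⟨e.toRingEquiv, e.commutes⟩

/-- A quadric bundle whose chart equation is `P + Q X₄`, with `Q` prime and not dividing the
equation, is rational. -/
theorem isRationalFunctionField_of_chartPoly_linear (A : Fin 4 → Fin 4 → MvPolynomial (Fin 3) ℂ)
    (P Q : MvPolynomial (Fin 4) ℂ)
    (hf : quadricBundleChartPoly A =
      MvPolynomial.rename Fin.castSucc P + MvPolynomial.rename Fin.castSucc Q * MvPolynomial.X 4)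
    (hQ : Prime (MvPolynomial.rename Fin.castSucc Q : MvPolynomial (Fin 5) ℂ))
    (hQf : ¬ MvPolynomial.rename Fin.castSucc Q ∣ quadricBundleChartPoly A) :
    IsRationalFunctionField (quadricBundleFFMap A) := by
  set f := quadricBundleChartPoly A with hfdef
  set ι : MvPolynomial (Fin 4) ℂ →ₐ[ℂ] MvPolynomial (Fin 5) ℂ := MvPolynomial.rename Fin.castSucc
  let K := FractionRing (MvPolynomial (Fin 4) ℂ)
  let κ := algebraMap (MvPolynomial (Fin 4) ℂ) K
  have hκ : Function.Injective κ := IsFractionRing.injective _ _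
  have hQ0 : Q ≠ 0 := by
    rintro rfl
    simp at hQ
  have hκQ : κ Q ≠ 0 := (map_ne_zero_iff _ hκ).mpr hQ0
  let φ : MvPolynomial (Fin 5) ℂ →ₐ[ℂ] K :=
    MvPolynomial.aeval (Fin.snoc (fun i => κ (MvPolynomial.X i)) (-κ P / κ Q) : Fin 5 → K)
  have hφι : ∀ G, φ (ι G) = κ G := by
    have : φ.comp ι = IsScalarTower.toAlgHom ℂ (MvPolynomial (Fin 4) ℂ) K := by
      ext i
      simp [φ, ι, κ]
    exact DFunLike.congr_fun this
  have hφ4 : φ (MvPolynomial.X 4) = -κ P / κ Q := by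
    simp only [φ, MvPolynomial.aeval_X]
    exact Fin.snoc_last (α := fun _ => K) _ _
  have hφf : φ f = 0 := by
    rw [hf, map_add, map_mul, hφι, hφι, hφ4]
    rw [← mul_div_assoc, mul_div_cancel_left₀ _ hκQ, add_neg_cancel]
  have hred : ∀ F, ∃ (N : ℕ) (G : MvPolynomial (Fin 4) ℂ), f ∣ ι Q ^ N * F - ι G := by
    intro F
    induction F using MvPolynomial.induction_on with
    | C a => exact ⟨0, MvPolynomial.C a, by simp [ι]⟩
    | add F₁ F₂ h₁ h₂ =>
      obtain ⟨N₁, G₁, u₁, h₁⟩ := h₁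
      obtain ⟨N₂, G₂, u₂, h₂⟩ := h₂
      refine ⟨N₁ + N₂, Q ^ N₂ * G₁ + Q ^ N₁ * G₂, ι Q ^ N₂ * u₁ + ι Q ^ N₁ * u₂, ?_⟩
      simp only [map_add, map_mul, map_pow]
      linear_combination ι Q ^ N₂ * h₁ + ι Q ^ N₁ * h₂
    | mul_X F i h =>
      obtain ⟨N, G, u, h⟩ := h
      induction i using Fin.lastCases with
      | cast i =>
        refine ⟨N, G * MvPolynomial.X i, u * MvPolynomial.X i.castSucc, ?_⟩
        simp only [map_mul, ι, MvPolynomial.rename_X] at h ⊢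
        linear_combination MvPolynomial.X i.castSucc * h
      | last =>
        refine ⟨N + 1, -G * P, u * ι Q * MvPolynomial.X 4 + ι G, ?_⟩
        change _ * (F * MvPolynomial.X 4) - _ = _
        simp only [map_mul, map_neg]
        linear_combination ι Q * MvPolynomial.X 4 * h - ι G * hf
  have hker : ∀ F, φ F = 0 → f ∣ F := by
    intro F hF
    obtain ⟨N, G, u, h⟩ := hred F
    have hG : G = 0 := by
      have := congrArg φ h
      simp only [map_sub, map_mul, map_pow, hF, hφι, hφf] at this
      apply hκ
      simpa using this
    rw [hG, map_zero, sub_zero] at h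
    obtain ⟨w, rfl⟩ : ι Q ^ N ∣ u := hQ.pow_dvd_of_dvd_mul_left N hQf ⟨F, h.symm⟩
    refine ⟨w, mul_left_cancel₀ (pow_ne_zero N hQ.ne_zero) ?_⟩
    rw [h]
    ring
  let π : quadricBundleChartRing A →+* K :=
    Ideal.Quotient.lift (Ideal.span {f}) φ.toRingHom (fun a ha => by
      obtain ⟨c, rfl⟩ := Ideal.mem_span_singleton.mp ha
      simp [hφf])
  have hπ : ∀ F, π (Ideal.Quotient.mk (Ideal.span {f}) F) = φ F := fun F => rfl
  have hπinj : Function.Injective π := by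
    rw [injective_iff_map_eq_zero]
    intro a ha
    obtain ⟨F, rfl⟩ := Ideal.Quotient.mk_surjective (I := Ideal.span {f}) a
    exact Ideal.Quotient.eq_zero_iff_mem.mpr (Ideal.mem_span_singleton.mpr (hker F ha))
  obtain ⟨e, he⟩ := FractionRing.exists_ringEquiv_of_injective π hπinj fun z => by
    obtain ⟨a, b, _, rfl⟩ := IsFractionRing.div_surjective (A := MvPolynomial (Fin 4) ℂ) z
    refine ⟨Ideal.Quotient.mk (Ideal.span {f}) (ι a), Ideal.Quotient.mk (Ideal.span {f}) (ι b), ?_⟩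
    rw [hπ, hπ, hφι, hφι]
  refine ⟨4, e, RingHom.ext fun z => (he _).trans ?_⟩
  change φ (MvPolynomial.C z) = κ (MvPolynomial.C z)
  rw [← hφι]
  simp [ι]

/-- The symmetric matrix of the quadratic form `∑ bᵢ zᵢ² + 2 z₃ ∑ aᵢ zᵢ` (`i ≤ 2`). -/
def sectionMatrix {R : Type*} [Zero R] (b a : Fin 3 → R) : Fin 4 → Fin 4 → R :=
  ![![b 0, 0, 0, a 0], ![0, b 1, 0, a 1], ![0, 0, b 2, a 2], ![a 0, a 1, a 2, 0]]

/-- The Fermat-type form `∑ₖ t_{ik} xₖ^{dᵢ}`. -/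
def fermatForm (d : Fin 4 → ℕ) (t : Fin 3 × Fin 3 → ℂ) (i : Fin 3) : MvPolynomial (Fin 3) ℂ :=
  ∑ k, MvPolynomial.C (t (i, k)) * MvPolynomial.X k ^ d i.castSucc

/-- The monomial `xᵢ^{(dᵢ + d₃) / 2}`. -/
def powerForm (d : Fin 4 → ℕ) (i : Fin 3) : MvPolynomial (Fin 3) ℂ :=
  MvPolynomial.X i ^ ((d i.castSucc + d 3) / 2)

/-- The bundle with diagonal entries `fermatForm`, last row `powerForm` and `a₃₃ = 0`. -/
def sectionBundle (d : Fin 4 → ℕ) (t : Fin 3 × Fin 3 → ℂ) :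
    Fin 4 → Fin 4 → MvPolynomial (Fin 3) ℂ :=
  sectionMatrix (fermatForm d t) (powerForm d)

theorem sectionBundle_isHomogeneous (d : Fin 4 → ℕ) (t : Fin 3 × Fin 3 → ℂ) (i j : Fin 4) :
    (sectionBundle d t i j).IsHomogeneous ((d i + d j) / 2) := by
  have hb : ∀ k : Fin 3, (fermatForm d t k).IsHomogeneous ((d k.castSucc + d k.castSucc) / 2) := by
    intro k
    rw [← two_mul, Nat.mul_div_cancel_left _ two_pos]
    refine MvPolynomial.IsHomogeneous.sum _ _ _ fun l _ => ?_
    simpa using (MvPolynomial.isHomogeneous_C _ _).mul (MvPolynomial.isHomogeneous_X_pow l _)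
  have ha : ∀ k : Fin 3, (powerForm d k).IsHomogeneous ((d k.castSucc + d 3) / 2) :=
    fun k => MvPolynomial.isHomogeneous_X_pow _ _
  have ha' : ∀ k : Fin 3, (powerForm d k).IsHomogeneous ((d 3 + d k.castSucc) / 2) :=
    fun k => by rw [add_comm]; exact ha k
  fin_cases i <;> fin_cases j <;>
    first
      | exact MvPolynomial.isHomogeneous_zero _ _ _
      | exact hb 0
      | exact hb 1
      | exact hb 2
      | exact ha 0
      | exact ha 1
      | exact ha 2
      | exact ha' 0
      | exact ha' 1
      | exact ha' 2

theorem det_sectionMatrix_add_transpose {R : Type*} [CommRing R] (b a : Fin 3 → R) :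
    Matrix.det (Matrix.of fun i j => sectionMatrix b a i j + sectionMatrix b a j i) =
      -16 * (a 0 ^ 2 * b 1 * b 2 + a 1 ^ 2 * b 0 * b 2 + a 2 ^ 2 * b 0 * b 1) := by
  simp [Matrix.det_succ_row_zero, Fin.sum_univ_succ, sectionMatrix, Fin.succAbove, Matrix.submatrix]
  ring

theorem isQuadricBundleP2_sectionBundle (d : Fin 4 → ℕ) {t : Fin 3 × Fin 3 → ℂ}
    {D : Fin 3 × Fin 3 → Derivation ℚ ℂ ℂ} (hD : ∀ i j, D i (t j) = if i = j then 1 else 0) :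
    IsQuadricBundleP2 (sectionBundle d t) := by
  constructor
  · intro h
    rw [sectionBundle, det_sectionMatrix_add_transpose] at h
    have h0 := congrArg (MvPolynomial.eval ![1, 0, 0]) h
    have hz : ∀ (n : ℕ) (x : Fin 3 × Fin 3), D x (0 ^ n) = 0 := by
      intro n x
      rcases n with _ | n <;> simp
    simp only [map_mul, map_add, map_pow, map_neg, fermatForm, powerForm, MvPolynomial.eval_X,
      MvPolynomial.eval_C, Fin.sum_univ_three, map_zero, map_ofNat] at h0
    simp only [Matrix.cons_val, one_pow, one_mul, mul_one, neg_mul, neg_eq_zero, mul_eq_zero,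
      OfNat.ofNat_ne_zero, false_or] at h0
    have h1 := congrArg (D (1, 0)) h0
    simp [Derivation.leibniz, Derivation.leibniz_pow, hD, hz] at h1
    have h2 := congrArg (D (2, 0)) h1
    simp [Derivation.leibniz, Derivation.leibniz_pow, hD, hz] at h2
  · intro v hv
    obtain ⟨k, hk⟩ := Function.ne_iff.mp hv
    refine ⟨k.castSucc, 3, ?_⟩
    have : sectionBundle d t k.castSucc 3 + sectionBundle d t 3 k.castSucc = 2 * powerForm d k := by
      fin_cases k <;> simp [sectionBundle, sectionMatrix, two_mul]
    rw [this]
    simpa [powerForm] using fun h => absurd h hk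

theorem hasRationalSectionP2_sectionBundle (d : Fin 4 → ℕ) (t : Fin 3 × Fin 3 → ℂ) :
    HasRationalSectionP2 (sectionBundle d t) := by
  refine ⟨Pi.single 3 1, by simp, ?_⟩
  simp [sectionBundle, sectionMatrix, Pi.single_apply]

/-- Bertini's argument: at a singular point, applying `∂/∂t_{ic}` to the equation gives `zᵢ² = 0`. -/
theorem isSmoothBundleP2_sectionBundle (d : Fin 4 → ℕ) {t : Fin 3 × Fin 3 → ℂ}
    {D : Fin 3 × Fin 3 → Derivation ℚ ℂ ℂ} (hD : ∀ i j, D i (t j) = if i = j then 1 else 0) :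
    IsSmoothBundleP2 (sectionBundle d t) := by
  intro c p hp h
  apply hp
  set x := chartSubstP2 c with hx
  have hxc : x c = 1 := by fin_cases c <;> rfl
  have hx01 : ∀ k, x k = 1 ∨ x k = MvPolynomial.X 0 ∨ x k = MvPolynomial.X 1 := by
    intro k
    fin_cases c <;> fin_cases k <;> simp [hx, chartSubstP2]
  have hxd : ∀ m : Fin 6, 2 ≤ m → ∀ k, MvPolynomial.pderiv m (x k) = 0 := by
    intro m hm k
    have h0 : (0 : Fin 6) ≠ m := by rintro rfl; simp at hm
    have h1 : (1 : Fin 6) ≠ m := by rintro rfl; simp at hm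
    rcases hx01 k with h | h | h <;> simp [h, h0, h1]
  set α := fun i => MvPolynomial.aeval x (powerForm d i) with hα
  set β := fun i => MvPolynomial.aeval x (fermatForm d t i) with hβ
  have hαd : ∀ m : Fin 6, 2 ≤ m → ∀ k, MvPolynomial.pderiv m (α k) = 0 := by
    intro m hm k
    simp [hα, powerForm, Derivation.leibniz_pow, hxd m hm]
  have hβd : ∀ m : Fin 6, 2 ≤ m → ∀ k, MvPolynomial.pderiv m (β k) = 0 := by
    intro m hm k
    simp [hβ, fermatForm, Derivation.leibniz_pow, hxd m hm, MvPolynomial.algebraMap_eq]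
  have hf : bundleTotalChartPoly c (sectionBundle d t) =
      β 0 * MvPolynomial.X 2 ^ 2 + β 1 * MvPolynomial.X 3 ^ 2 + β 2 * MvPolynomial.X 4 ^ 2 +
        MvPolynomial.C 2 * MvPolynomial.X 5 *
          (α 0 * MvPolynomial.X 2 + α 1 * MvPolynomial.X 3 + α 2 * MvPolynomial.X 4) := by
    simp only [bundleTotalChartPoly, sectionBundle, sectionMatrix, Fin.sum_univ_four,
      Matrix.cons_val, map_zero, map_ofNat, hα, hβ, hx]
    ring
  have e2 := h 2
  have e3 := h 3
  have e4 := h 4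
  have e5 := h 5
  have hX : ∀ m n : Fin 6, m ≠ n → MvPolynomial.pderiv m (MvPolynomial.X n : MvPolynomial (Fin 6) ℂ) = 0 :=
    fun m n hmn => MvPolynomial.pderiv_X_of_ne hmn.symm
  simp [hf, Derivation.leibniz_pow, hαd, hβd, hX] at e2 e3 e4 e5
  have hF : MvPolynomial.eval p (bundleTotalChartPoly c (sectionBundle d t)) = 0 := by
    simp only [hf, map_add, map_mul, map_pow, MvPolynomial.eval_X, MvPolynomial.eval_C]
    linear_combination p 2 / 2 * e2 + p 3 / 2 * e3 + p 4 / 2 * e4 + p 5 * e5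
  have hz : ∀ i : Fin 3, ![p 2, p 3, p 4] i = 0 := by
    intro i
    obtain ⟨E, hC, hEX, hmul, hE⟩ := MvPolynomial.exists_coeff_derivation (D (i, c)) p
    have key := hE _ h hF
    have hE1 : E 1 = 0 := by simpa using hC 1
    have hEpow : ∀ (f : MvPolynomial (Fin 6) ℂ) (n : ℕ), E f = 0 → E (f ^ n) = 0 := by
      intro f n hf
      induction n with
      | zero => simpa using hE1
      | succ n ih => rw [pow_succ, hmul, hf, ih]; simp
    have hEx : ∀ k n, E (x k ^ n) = 0 := by
      intro k n
      apply hEpow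
      rcases hx01 k with h | h | h <;> simp [h, hE1, hEX]
    have hEα : ∀ j, E (α j) = 0 := by
      intro j
      simp [hα, powerForm, hEx]
    have hEβ : ∀ j, E (β j) = if i = j then 1 else 0 := by
      intro j
      simp [hβ, fermatForm, hmul, hEx, hC, hD, MvPolynomial.algebraMap_eq, ite_and, hxc]
    rw [hf] at key
    simp [hmul, hEα, hEβ, hEX, hEpow, hC] at key
    rw [e5, zero_mul, add_zero] at key
    fin_cases i <;> simpa using key
  have h2 : p 2 = 0 := hz 0
  have h3 : p 3 = 0 := hz 1
  have h4 : p 4 = 0 := hz 2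
  have hαc : MvPolynomial.eval p (α c) = 1 := by simp [hα, powerForm, hxc]
  have h5α : ∀ k, p 5 = 0 ∨ MvPolynomial.eval p (α k) = 0 := by
    intro k
    fin_cases k
    · simpa [h2] using e2
    · simpa [h3] using e3
    · simpa [h4] using e4
  have h5 : p 5 = 0 := (h5α c).resolve_right (by simp [hαc])
  simp [h2, h3, h4, h5]

theorem isRationalFunctionField_sectionBundle (d : Fin 4 → ℕ) {t : Fin 3 × Fin 3 → ℂ}
    {D : Fin 3 × Fin 3 → Derivation ℚ ℂ ℂ} (hD : ∀ i j, D i (t j) = if i = j then 1 else 0) :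
    IsRationalFunctionField (quadricBundleFFMap (sectionBundle d t)) := by
  let x : Fin 3 → MvPolynomial (Fin 4) ℂ := ![MvPolynomial.X 0, MvPolynomial.X 1, 1]
  let β := fun i => MvPolynomial.aeval x (fermatForm d t i)
  let α := fun i => MvPolynomial.aeval x (powerForm d i)
  let r := α 0 + α 1 * MvPolynomial.X 2
  let P := β 0 + β 1 * MvPolynomial.X 2 ^ 2 + β 2 * MvPolynomial.X 3 ^ 2
  let Q := MvPolynomial.C 2 * (MvPolynomial.X 3 + r)
  let ι : MvPolynomial (Fin 4) ℂ →ₐ[ℂ] MvPolynomial (Fin 5) ℂ := MvPolynomial.rename Fin.castSucc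
  have hι : ∀ F, ι (MvPolynomial.aeval x F) = dehomP2 F := by
    intro F
    have : ι.comp (MvPolynomial.aeval x) =
        MvPolynomial.aeval ![MvPolynomial.X 0, MvPolynomial.X 1, 1] := by
      ext i
      fin_cases i <;> simp [ι, x]
    exact DFunLike.congr_fun this F
  have hf : quadricBundleChartPoly (sectionBundle d t) = ι P + ι Q * MvPolynomial.X 4 := by
    have h2 : dehomP2 (powerForm d 2) = 1 := by simp [dehomP2, powerForm]
    simp only [quadricBundleChartPoly, sectionBundle, sectionMatrix, Fin.sum_univ_four,
      Matrix.cons_val, map_zero, P, Q, r, α, β, map_add, map_mul, map_pow, hι, h2]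
    have hC : (MvPolynomial.C 2 : MvPolynomial (Fin 5) ℂ) = 2 := map_ofNat _ 2
    simp [ι, hC]
    ring
  let ψ : MvPolynomial (Fin 5) ℂ →ₐ[ℂ] MvPolynomial (Fin 5) ℂ :=
    MvPolynomial.aeval ![MvPolynomial.X 0, MvPolynomial.X 1, MvPolynomial.X 2, - ι r, MvPolynomial.X 4]
  have hψx : ∀ F, ψ (dehomP2 F) = dehomP2 F := by
    intro F
    have : ψ.comp (MvPolynomial.aeval ![MvPolynomial.X 0, MvPolynomial.X 1, 1]) =
        MvPolynomial.aeval ![MvPolynomial.X 0, MvPolynomial.X 1, 1] := by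
      ext i
      fin_cases i <;> simp [ψ]
    exact DFunLike.congr_fun this F
  have hψr : ψ (ι r) = ι r := by
    simp only [r, α, map_add, map_mul, hι, hψx]
    simp [ι, ψ]
  have hιX3 : ι (MvPolynomial.X 3) = MvPolynomial.X 3 := by simp [ι]
  have hψX3 : ψ (MvPolynomial.X 3) = - ι r := by simp [ψ]
  have hψq : ψ (ι (MvPolynomial.X 3 + r)) = 0 := by
    rw [map_add, hιX3, map_add, hψr, hψX3, neg_add_cancel]
  have heval : ∀ (u v : ℂ) F, MvPolynomial.eval ![1, 0, 0, u, v] (dehomP2 F) =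
      MvPolynomial.eval ![1, 0, 1] F := by
    intro u v F
    have : (MvPolynomial.aeval (R := ℂ) ![1, 0, 0, u, v]).comp
        (MvPolynomial.aeval ![MvPolynomial.X 0, MvPolynomial.X 1, 1]) =
        MvPolynomial.aeval ![1, 0, 1] := by
      ext i
      fin_cases i <;> simp
    exact DFunLike.congr_fun this F
  have hevalr : ∀ u v : ℂ, MvPolynomial.eval ![1, 0, 0, u, v] (ι r) = 1 := by
    intro u v
    simp only [r, α, map_add, map_mul, hι, heval]
    simp [ι, powerForm]
  have hψf : ψ (quadricBundleChartPoly (sectionBundle d t)) ≠ 0 := by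
    rw [hf, map_add, map_mul, (show ι Q = ι (MvPolynomial.C 2) * _ from map_mul _ _ _), map_mul ψ,
      hψq, mul_zero, zero_mul, add_zero]
    simp only [P, β, map_add, map_mul, map_pow, hι, hψx, hιX3, hψX3]
    intro h0
    have h1 := congrArg (MvPolynomial.eval ![1, 0, 0, 0, 0]) h0
    simp only [map_add, map_mul, map_pow, map_neg, heval, hevalr] at h1
    have h2 := congrArg (D (0, 2)) h1
    simp [fermatForm, ι, ψ, Fin.sum_univ_three, Derivation.leibniz, Derivation.leibniz_pow, hD] at h2
  have hprime : Prime (ι (MvPolynomial.X 3 + r)) := by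
    refine MvPolynomial.prime_of_retraction ψ (fun j => ?_) hψq fun h0 => ?_
    · fin_cases j
      · simp [ψ]
      · simp [ψ]
      · simp [ψ]
      · change _ ∣ MvPolynomial.X 3 - ψ (MvPolynomial.X 3)
        rw [hψX3, map_add, hιX3, sub_neg_eq_add]
      · simp [ψ]
    · have h1 := congrArg (MvPolynomial.eval ![1, 0, 0, 1, 0]) h0
      rw [map_add, hιX3, map_add, hevalr] at h1
      simp [one_add_one_eq_two] at h1
  have hQ : Associated (ι (MvPolynomial.X 3 + r)) (ι Q) := by
    have h2 : IsUnit (MvPolynomial.C 2 : MvPolynomial (Fin 4) ℂ) := (IsUnit.mk0 2 two_ne_zero).map _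
    exact (associated_unit_mul_right _ _ h2).map ι
  refine isRationalFunctionField_of_chartPoly_linear _ P Q hf (hQ.prime hprime) fun hdvd => ?_
  apply hψf
  obtain ⟨u, hu⟩ := hQ.dvd.trans hdvd
  rw [hu, map_mul, hψq, zero_mul]

theorem smooth_quadric_bundle_P2_deforms_to_rational_with_section
    (d : Fin 4 → ℕ) (hpar : ∀ i j, Even (d i + d j))
    -- given any smooth quadric surface bundle `X → ℙ²` of type `(d₀,…,d₃)` ...
    (A : Π i : Fin 4, Π j : Fin 4,
      (MvPolynomial.homogeneousSubmodule (Fin 3) ℂ ((d i + d j) / 2)))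
    (hA : IsQuadricBundleP2 (fun i j => (A i j : MvPolynomial (Fin 3) ℂ)))
    (hAsm : IsSmoothBundleP2 (fun i j => (A i j : MvPolynomial (Fin 3) ℂ))) :
    -- ... there is a member of the same family with `a₃₃ = 0`, which is a smooth quadric
    -- surface bundle admitting a section, and which is rational
    ∃ B : Π i : Fin 4, Π j : Fin 4,
      (MvPolynomial.homogeneousSubmodule (Fin 3) ℂ ((d i + d j) / 2)),
      (B 3 3 : MvPolynomial (Fin 3) ℂ) = 0 ∧
      IsQuadricBundleP2 (fun i j => (B i j : MvPolynomial (Fin 3) ℂ)) ∧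
      IsSmoothBundleP2 (fun i j => (B i j : MvPolynomial (Fin 3) ℂ)) ∧
      HasRationalSectionP2 (fun i j => (B i j : MvPolynomial (Fin 3) ℂ)) ∧
      IsRationalFunctionField
        (quadricBundleFFMap (fun i j => (B i j : MvPolynomial (Fin 3) ℂ))) := by
  obtain ⟨t, D, hD⟩ := exists_dual_derivations (Fin 3 × Fin 3)
  exact ⟨fun i j => ⟨sectionBundle d t i j,
      (MvPolynomial.mem_homogeneousSubmodule _ _).mpr (sectionBundle_isHomogeneous d t i j)⟩,
    rfl, isQuadricBundleP2_sectionBundle d hD, isSmoothBundleP2_sectionBundle d hD,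
    hasRationalSectionP2_sectionBundle d t, isRationalFunctionField_sectionBundle d hD⟩

end
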